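/- Let n₁, n₂ ≥ 1, N = n₁ + n₂, and let P be the N×N block matrix P = [[0, P_B],[0, P₂]], where P_B is an n₁×n₂ nonnegative matrix whose rows each sum to 1, and P₂ is an n₂×n₂ row-stochastic irreducible matrix. Let λ ∈ (0,1) and let c₂ be the left Perron vector of P₂. Then: (a) no vector v ∈ ℝ^N with all entries strictly positive and Σᵢ vᵢ = 1 satisfies (1−λ)vᵀ(I − λP)⁻¹ = vᵀ; (b) there is exactly one vector v ∈ ℝ^N with all entries nonnegative and Σᵢ vᵢ = 1 satisfying (1−λ)vᵀ(I − λP)⁻¹ = vᵀ, namely v = (0_{n₁} | c₂). -/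

import Mathlib

open Matrix Filter Topology

lemma perron_unique {n : ℕ} (P : Matrix (Fin n) (Fin n) ℝ) (hn : 1 ≤ n)
    (h0 : ∀ i j, 0 ≤ P i j) (hirr : ∀ i j, ∃ k, 1 ≤ k ∧ 0 < (P ^ k) i j)
    (c : Fin n → ℝ) (hc : ∀ i, 0 < c i) (hcs : ∑ i, c i = 1) (hcP : c ᵥ* P = c)
    (w : Fin n → ℝ) (hws : ∑ i, w i = 1) (hwP : w ᵥ* P = w) : w = c := by
  haveI : Nonempty (Fin n) := ⟨⟨0, hn⟩⟩
  obtain ⟨i0, hi0⟩ := Finite.exists_min (fun i => w i / c i)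
  set t := w i0 / c i0 with ht
  have hu : (w - t • c) ᵥ* P = w - t • c := by
    rw [Matrix.sub_vecMul, Matrix.smul_vecMul, hcP, hwP]
  have hunn : ∀ i, 0 ≤ (w - t • c) i := by
    intro i
    have := (le_div_iff₀ (hc i)).1 (hi0 i)
    simp only [Pi.sub_apply, Pi.smul_apply, smul_eq_mul]
    linarith
  have hu0 : (w - t • c) i0 = 0 := by
    simp only [Pi.sub_apply, Pi.smul_apply, smul_eq_mul, ht]
    rw [div_mul_cancel₀ _ (hc i0).ne']; ring
  generalize hud : w - t • c = u at *
  have hpow : ∀ k, u ᵥ* (P ^ k) = u := by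
    intro k
    induction k with
    | zero => simp
    | succ k ih => rw [pow_succ, ← Matrix.vecMul_vecMul, ih, hu]
  have hPk : ∀ k, ∀ i j, 0 ≤ (P ^ k) i j := by
    intro k
    induction k with
    | zero => intro i j; simp only [pow_zero, Matrix.one_apply]; split_ifs <;> norm_num
    | succ k ih =>
      intro i j
      rw [pow_succ, Matrix.mul_apply]
      exact Finset.sum_nonneg fun l _ => mul_nonneg (ih _ _) (h0 _ _)
  have hz : ∀ j, u j = 0 := by
    intro j
    obtain ⟨k, -, hk⟩ := hirr j i0
    have h := congrFun (hpow k) i0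
    rw [hu0] at h
    have h' : ∑ l, u l * (P ^ k) l i0 = 0 := h
    have := (Finset.sum_eq_zero_iff_of_nonneg
      (fun l _ => mul_nonneg (hunn l) (hPk k l i0))).1 h' j (Finset.mem_univ _)
    exact (mul_eq_zero.1 this).resolve_right hk.ne'
  have hw : ∀ i, w i = t * c i := by
    intro i
    have := hz i
    rw [← hud] at this
    simp only [Pi.sub_apply, Pi.smul_apply, smul_eq_mul] at this
    linarith
  have ht1 : t = 1 := by
    have : ∑ i, w i = t * ∑ i, c i := by
      rw [Finset.mul_sum]; exact Finset.sum_congr rfl fun i _ => hw i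
    rw [hws, hcs] at this; linarith
  funext i
  rw [hw, ht1, one_mul]

lemma fixed_iff {ι : Type*} [Fintype ι] [DecidableEq ι] (P : Matrix ι ι ℝ)
    (h0 : ∀ i j, 0 ≤ P i j) (h1 : ∀ i, ∑ j, P i j = 1)
    (lam : ℝ) (hl0 : 0 < lam) (hl1 : lam < 1) (v : ι → ℝ) :
    (1 - lam) • (v ᵥ* (1 - lam • P)⁻¹) = v ↔ v ᵥ* P = v := by
  have hdet : (1 - lam • P).det ≠ 0 := by
    apply det_ne_zero_of_sum_row_lt_diag
    intro k
    have e : ∑ j ∈ Finset.univ.erase k, ‖(1 - lam • P) k j‖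
        = ∑ j ∈ Finset.univ.erase k, lam * P k j := by
      apply Finset.sum_congr rfl
      intro j hj
      have hjk : k ≠ j := (Finset.ne_of_mem_erase hj).symm
      simp [Matrix.one_apply, hjk, abs_of_nonneg (h0 k j), abs_of_pos hl0]
    have e2 := Finset.add_sum_erase Finset.univ (fun j => P k j) (Finset.mem_univ k)
    simp only [h1 k] at e2
    rw [e, ← Finset.mul_sum]
    have : (1 - lam • P) k k = 1 - lam * P k k := by simp
    rw [this, Real.norm_eq_abs]
    refine lt_of_lt_of_le ?_ (le_abs_self _)
    nlinarith
  have hU : IsUnit (1 - lam • P).det := isUnit_iff_ne_zero.2 hdet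
  have key : (1 - lam) • (v ᵥ* (1 - lam • P)⁻¹) = v ↔ (1 - lam) • v = v ᵥ* (1 - lam • P) := by
    constructor
    · intro h
      conv_rhs => rw [← h]
      rw [Matrix.smul_vecMul, Matrix.vecMul_vecMul, Matrix.nonsing_inv_mul _ hU, Matrix.vecMul_one]
    · intro h
      rw [← Matrix.smul_vecMul, h, Matrix.vecMul_vecMul, Matrix.mul_nonsing_inv _ hU,
        Matrix.vecMul_one]
  rw [key, Matrix.vecMul_sub, Matrix.vecMul_one, Matrix.vecMul_smul, sub_smul, one_smul]
  constructor
  · intro h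
    exact (smul_right_injective _ hl0.ne' (sub_right_injective h)).symm
  · intro h
    rw [h]

theorem stmt13 {n₁ n₂ : ℕ} (h1 : 1 ≤ n₁) (h2 : 1 ≤ n₂)
    (PB : Matrix (Fin n₁) (Fin n₂) ℝ) (P₂ : Matrix (Fin n₂) (Fin n₂) ℝ)
    (hPB0 : ∀ i j, 0 ≤ PB i j) (hPB1 : ∀ i, ∑ j, PB i j = 1)
    (hP₂0 : ∀ i j, 0 ≤ P₂ i j) (hP₂1 : ∀ i, ∑ j, P₂ i j = 1)
    (hP₂irr : ∀ i j, ∃ k, 1 ≤ k ∧ 0 < (P₂ ^ k) i j)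
    (lam : ℝ) (hl0 : 0 < lam) (hl1 : lam < 1)
    (c₂ : Fin n₂ → ℝ) (hc₂pos : ∀ i, 0 < c₂ i) (hc₂sum : ∑ i, c₂ i = 1)
    (hc₂ : c₂ ᵥ* P₂ = c₂) :
    (¬ ∃ v : Fin n₁ ⊕ Fin n₂ → ℝ, (∀ i, 0 < v i) ∧ (∑ i, v i = 1) ∧
      (1 - lam) • (v ᵥ* (1 - lam • Matrix.fromBlocks 0 PB 0 P₂)⁻¹) = v) ∧
    (∀ v : Fin n₁ ⊕ Fin n₂ → ℝ,
      ((∀ i, 0 ≤ v i) ∧ (∑ i, v i = 1) ∧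
        (1 - lam) • (v ᵥ* (1 - lam • Matrix.fromBlocks 0 PB 0 P₂)⁻¹) = v) ↔
      v = Sum.elim (0 : Fin n₁ → ℝ) c₂) := by
  have hP0 : ∀ i j, 0 ≤ (Matrix.fromBlocks 0 PB 0 P₂ :
      Matrix (Fin n₁ ⊕ Fin n₂) (Fin n₁ ⊕ Fin n₂) ℝ) i j := by
    rintro (i | i) (j | j) <;> simp [hPB0, hP₂0]
  have hP1 : ∀ i, ∑ j, (Matrix.fromBlocks 0 PB 0 P₂ :
      Matrix (Fin n₁ ⊕ Fin n₂) (Fin n₁ ⊕ Fin n₂) ℝ) i j = 1 := by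
    rintro (i | i) <;> simp [hPB1, hP₂1]
  have main : ∀ v : Fin n₁ ⊕ Fin n₂ → ℝ,
      ((∀ i, 0 ≤ v i) ∧ (∑ i, v i = 1) ∧
        (1 - lam) • (v ᵥ* (1 - lam • Matrix.fromBlocks 0 PB 0 P₂)⁻¹) = v) ↔
      v = Sum.elim (0 : Fin n₁ → ℝ) c₂ := by
    intro v
    rw [fixed_iff _ hP0 hP1 lam hl0 hl1]
    constructor
    · rintro ⟨-, hs, hv⟩
      rw [Matrix.vecMul_fromBlocks] at hv
      have hl : v ∘ Sum.inl = 0 := by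
        funext i
        have := congrFun hv (Sum.inl i)
        simpa using this.symm
      have hr : (v ∘ Sum.inr) ᵥ* P₂ = v ∘ Sum.inr := by
        funext i
        have := congrFun hv (Sum.inr i)
        simpa [hl] using this
      have hs2 : ∑ i, (v ∘ Sum.inr) i = 1 := by
        rw [Fintype.sum_sum_type] at hs
        have h' : ∑ i, v (Sum.inl i) = 0 :=
          Finset.sum_eq_zero fun i _ => congrFun hl i
        rw [h', zero_add] at hs
        exact hs
      have := perron_unique P₂ h2 hP₂0 hP₂irr c₂ hc₂pos hc₂sum hc₂ _ hs2 hr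
      rw [← hl, ← this, Sum.elim_comp_inl_inr]
    · rintro rfl
      refine ⟨?_, ?_, ?_⟩
      · rintro (i | i)
        · simp
        · simpa using (hc₂pos i).le
      · simp [hc₂sum]
      · rw [Matrix.vecMul_fromBlocks]
        simp [hc₂]
  refine ⟨?_, main⟩
  rintro ⟨v, hp, hs, hv⟩
  have := (main v).1 ⟨fun i => (hp i).le, hs, hv⟩
  have h := hp (Sum.inl ⟨0, h1⟩)
  rw [this] at h
  simp at h
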